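/- Let m ≥ 0 be an integer and let R = ℚ[ℏ,𝔟,Q_1,…,Q_m]. Then the following identity of R-linear operators on R[p̃] holds, where every sum over a bridge set is locally finite (for each polynomial input only finitely many summands act nonzero): Σ_{i=0}^{m} e_{m−i}(−Q_1,…,−Q_m) · Σ_{γ ∈ Γ^{≥0}_{(0,−1)→(i+2,−1)}} wt̃(γ|0) = Σ_{γ ∈ Γ^{≥0}_{(0,−1)→(m+2,−1)}} wt̃(γ|(0,−Q_1,…,−Q_m,0)), where (0,−Q_1,…,−Q_m,0) is the vector of length m+2 whose first and last entries are 0. -/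

import Mathlib

open MvPolynomial

noncomputable section Stmt2

/-- The coefficient ring `R = ℚ[ℏ, 𝔟, Q_1, …, Q_m]`. -/
abbrev RR (m : ℕ) : Type := MvPolynomial (Fin (m + 2)) ℚ

/-- The ring `R[p̃] = R[p̃_1, p̃_2, …]` (variable `k` stands for `p̃_k`; index `0` is unused). -/
abbrev PP (m : ℕ) : Type := MvPolynomial ℕ (RR m)

/-- The indeterminate `ℏ`. -/
def hb (m : ℕ) : RR m := X 0

/-- The indeterminate `𝔟`. -/
def bb (m : ℕ) : RR m := X 1

/-- The indeterminates `Q_1, …, Q_m` (zero-indexed). -/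
def Qv (m : ℕ) (i : Fin m) : RR m := X i.succ.succ

/-- The operators `J_k` on `R[p̃]`: `J_k = ℏ k ∂_{p̃_k}` for `k > 0`, `J_0 = 0`,
and `J_{-k} = ℏ·p̃_k` (multiplication) for `k > 0`. -/
def J (m : ℕ) (k : ℤ) : PP m → PP m :=
  if 0 < k then fun p => C (hb m) * (k.toNat : PP m) * pderiv k.toNat p
  else if k < 0 then fun p => C (hb m) * X (-k).toNat * p
  else 0

/-- The set of paths from `(x, y)` to `(x + N, y')`, encoded as the list of the `N`
successive height increments. -/
def PathSet (y : ℤ) (N : ℕ) (y' : ℤ) : Set (List ℤ) :=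
  {L | L.length = N ∧ y + L.sum = y'}

/-- The set of bridges from `(x, y)` to `(x + N, y')`: paths whose intermediate heights
`h_1, …, h_{N-1}` are all nonnegative. -/
def BridgeSet (y : ℤ) (N : ℕ) (y' : ℤ) : Set (List ℤ) :=
  {L | L ∈ PathSet y N y' ∧ ∀ j : ℕ, 0 < j → j < N → 0 ≤ y + (L.take j).sum}

/-- The weight `wt̃(γ|u)` of a path: processed from the left, at (1-based) position `u`
and current height `y`, a non-flat step of increment `d` contributes the operator
`J_{-d}` (i.e. `J_{h_{j-1} - h_j}`), while a flat step contributes scalar multiplication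
by `u_j − ℏ𝔟·h_j`. The first step's operator is applied last. -/
def wtT (m : ℕ) (uvec : ℕ → RR m) : ℕ → ℤ → List ℤ → PP m → PP m
  | _, _, [] => id
  | u, y, d :: rest =>
      (if d = 0 then (fun p => C (uvec u - hb m * bb m * (y : RR m)) * p) else J m (-d)) ∘
        wtT m uvec (u + 1) (y + d) rest

/-- The elementary symmetric polynomial `e_s(−Q_1, …, −Q_m)`. -/
def esymNegQ (m s : ℕ) : RR m :=
  ∑ t ∈ Finset.powersetCard s (Finset.univ : Finset (Fin m)), ∏ j ∈ t, (-Qv m j)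

/-- The weight vector `(0, −Q_1, …, −Q_m, 0)` (of length `m + 2`), as a function of the
1-based position. -/
def uvQ (m : ℕ) : ℕ → RR m := fun u =>
  if h : 2 ≤ u ∧ u ≤ m + 1 then -Qv m ⟨u - 2, by omega⟩ else 0

/-- One step of a path. -/
def stp (m : ℕ) (u : RR m) (y d : ℤ) : PP m → PP m :=
  if d = 0 then (fun p => C (u - hb m * bb m * (y : RR m)) * p) else J m (-d)

/-- List version of the weight. -/
def wl (m : ℕ) : List (RR m) → ℤ → List ℤ → PP m → PP m
  | u :: us, y, d :: L => fun p => stp m u y d (wl m us (y + d) L p)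
  | _, _, _ => id

/-- Tails of bridges: nonnegative heights until the end point at height `-1`. -/
def good : ℤ → List ℤ → Prop
  | y, [] => y = -1
  | y, d :: L => 0 ≤ y ∧ good (y + d) L

/-- Bridges from `-1` to `-1`. -/
def Br : List ℤ → Prop
  | [] => False
  | d :: L => good (-1 + d) L

lemma J_add (m : ℕ) (k : ℤ) (p q : PP m) : J m k (p + q) = J m k p + J m k q := by
  unfold J
  split_ifs
  · simp [mul_add]
  · simp [mul_add]
  · simp

lemma J_mul (m : ℕ) (k : ℤ) (c : RR m) (p : PP m) : J m k (C c * p) = C c * J m k p := by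
  unfold J
  split_ifs
  · simp only [pderiv_C_mul, smul_eq_C_mul]
    ring
  · simp only []; ring
  · simp

lemma stp_add (m : ℕ) (u : RR m) (y d : ℤ) (p q : PP m) :
    stp m u y d (p + q) = stp m u y d p + stp m u y d q := by
  unfold stp
  split_ifs
  · simp [mul_add]
  · exact J_add ..

lemma stp_mul (m : ℕ) (u : RR m) (y d : ℤ) (c : RR m) (p : PP m) :
    stp m u y d (C c * p) = C c * stp m u y d p := by
  unfold stp
  split_ifs
  · simp only []; ring
  · exact J_mul ..

lemma stp_zero (m : ℕ) (u : RR m) (y d : ℤ) : stp m u y d 0 = 0 := by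
  have := stp_mul m u y d 0 0
  simpa using this

lemma stp_finite (m : ℕ) (u : ℤ → RR m) (Y : ℤ → ℤ) (t : ℤ) (p : PP m) :
    {d : ℤ | d ≤ t ∧ stp m (u d) (Y d) d p ≠ 0}.Finite := by
  obtain ⟨M, hM⟩ : ∃ M : ℕ, ∀ k ∈ p.vars, k ≤ M := ⟨p.vars.sup id, fun k hk =>
    Finset.le_sup (f := id) hk⟩
  apply (Set.finite_Icc (-(M : ℤ)) (max t 0)).subset
  rintro d ⟨h1, h2⟩
  refine ⟨?_, le_max_of_le_left h1⟩
  by_contra hd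
  apply h2
  have h0 : d ≠ 0 := by omega
  have h3 : 0 < -d := by omega
  simp only [stp, h0, if_false, J, h3, if_true]
  rw [pderiv_eq_zero_of_notMem_vars, mul_zero]
  intro hk
  have := hM _ hk
  omega

lemma good_sum {y : ℤ} {L : List ℤ} (h : good y L) : y = -1 - L.sum := by
  induction L generalizing y with
  | nil => simpa [good] using h
  | cons d L ih =>
    have := ih h.2
    simp only [List.sum_cons]
    omega

lemma tail_finite (m : ℕ) (us : List (RR m)) (p : PP m) :
    {L : List ℤ | L.length = us.length ∧ good (-1 - L.sum) L ∧
      wl m us (-1 - L.sum) L p ≠ 0}.Finite := by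
  induction us with
  | nil =>
    apply (Set.finite_singleton ([] : List ℤ)).subset
    rintro L ⟨h, -⟩
    simpa using h
  | cons u us ih =>
    have key := ih.biUnion (t := fun L => (fun d => d :: L) ''
      {d : ℤ | d ≤ -1 - L.sum ∧ stp m u (-1 - L.sum - d) d (wl m us (-1 - L.sum) L p) ≠ 0})
      (fun L _ => (stp_finite m (fun _ => u) (fun d => -1 - L.sum - d) _ _).image _)
    apply key.subset
    rintro L ⟨h1, h2, h3⟩
    cases L with
    | nil => simp at h1
    | cons d L =>
      have e : -1 - (d :: L).sum + d = -1 - L.sum := by simp; ring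
      have e' : -1 - (d :: L).sum = -1 - L.sum - d := by simp; ring
      simp only [good, wl, e] at h2 h3
      rw [e'] at h2 h3
      simp only [Set.mem_iUnion]
      refine ⟨L, ⟨by simpa using h1, h2.2, ?_⟩, d, ⟨by omega, h3⟩, rfl⟩
      intro h
      rw [h, stp_zero] at h3
      exact h3 rfl

lemma br_finite (m : ℕ) (us : List (RR m)) (p : PP m) :
    {L : List ℤ | (Br L ∧ L.length = us.length) ∧ wl m us (-1) L p ≠ 0}.Finite := by
  cases us with
  | nil =>
    apply (Set.finite_singleton ([] : List ℤ)).subset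
    rintro L ⟨⟨-, h⟩, -⟩
    simpa using h
  | cons u us =>
    apply ((tail_finite m us p).image (fun L => (-L.sum) :: L)).subset
    rintro L ⟨⟨h2, h1⟩, h3⟩
    cases L with
    | nil => simp at h1
    | cons d L =>
      have h2 : good (-1 + d) L := h2
      have e := good_sum h2
      refine ⟨L, ⟨by simpa using h1, e ▸ h2, ?_⟩, ?_⟩
      · intro h
        rw [← e] at h
        apply h3
        simp only [wl, h, stp_zero]
      · simp only [List.cons.injEq, and_true]; omega

lemma wl_split (m : ℕ) (us1 us2 : List (RR m)) (u : RR m) (p : PP m) (y : ℤ) (L : List ℤ)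
    (hL : L.length = (us1 ++ u :: us2).length) :
    wl m (us1 ++ u :: us2) y L p = wl m (us1 ++ 0 :: us2) y L p +
      if L[us1.length]? = some 0 then
        C u * wl m (us1 ++ us2) y (L.eraseIdx us1.length) p else 0 := by
  induction us1 generalizing y L with
  | nil =>
    cases L with
    | nil => simp at hL
    | cons d L =>
      by_cases h : d = 0
      · subst h
        simp [wl, stp]
        ring
      · simp [wl, stp, h]
  | cons v us1 ih =>
    cases L with
    | nil => simp at hL
    | cons d L =>
      have := ih (y + d) L (by simpa using hL)
      simp only [List.cons_append, wl, List.length_cons, List.getElem?_cons_succ,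
        List.eraseIdx_cons_succ]
      rw [this, stp_add]
      split_ifs
      · rw [stp_mul]
      · rw [stp_zero]

lemma good_insert (k : ℕ) (L : List ℤ) (y : ℤ) (hk : k < L.length) :
    good y (L.insertIdx k 0) ↔ good y L := by
  induction k generalizing y L with
  | zero =>
    cases L with
    | nil => simp at hk
    | cons d L => simp [good]
  | succ k ih =>
    cases L with
    | nil => simp at hk
    | cons d L =>
      simp only [List.insertIdx_succ_cons, good]
      rw [ih _ _ (by simpa using hk)]

lemma insert_erase (k : ℕ) (L : List ℤ) (h : L[k]? = some 0) :
    (L.eraseIdx k).insertIdx k 0 = L := by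
  induction k generalizing L with
  | zero =>
    cases L with
    | nil => simp at h
    | cons d L => simp at h; simp [h]
  | succ k ih =>
    cases L with
    | nil => simp at h
    | cons d L => simp at h; simp [ih L h]

/-- The sum over bridges. -/
def W (m : ℕ) (p : PP m) (us : List (RR m)) : PP m :=
  ∑ᶠ L ∈ {L : List ℤ | Br L ∧ L.length = us.length}, wl m us (-1) L p

lemma W_split (m : ℕ) (p : PP m) (u0 u : RR m) (us1 us2 : List (RR m)) (h2 : us2 ≠ []) :
    W m p (u0 :: us1 ++ u :: us2) =
      W m p (u0 :: us1 ++ 0 :: us2) + C u * W m p (u0 :: us1 ++ us2) := by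
  set vs := u0 :: us1 with hvs
  set k := vs.length with hk
  set S := {L : List ℤ | Br L ∧ L.length = (vs ++ u :: us2).length} with hS
  set S' := {L : List ℤ | Br L ∧ L.length = (vs ++ us2).length} with hS'
  set g : List ℤ → PP m := fun L => if L[k]? = some 0 then
        C u * wl m (vs ++ us2) (-1) (L.eraseIdx k) p else 0 with hg
  have hl2 : 0 < us2.length := List.length_pos_iff.2 h2
  have hsp : ∀ L ∈ S, wl m (vs ++ u :: us2) (-1) L p =
      wl m (vs ++ 0 :: us2) (-1) L p + g L := fun L hL => wl_split m vs us2 u p (-1) L hL.2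
  have f1 := br_finite m (vs ++ u :: us2) p
  have f2 := br_finite m (vs ++ 0 :: us2) p
  have hSe : S = {L : List ℤ | Br L ∧ L.length = (vs ++ 0 :: us2).length} := by
    simp [hS]
  have hins : ∀ L ∈ S', L.insertIdx k 0 ∈ S := by
    rintro L ⟨hb, hl⟩
    cases L with
    | nil => exact hb.elim
    | cons d L =>
      simp only [hk, hvs, List.length_cons, List.insertIdx_succ_cons]
      simp only [hvs, List.length_cons, List.cons_append, List.length_append] at hl
      refine ⟨(good_insert _ _ _ (by omega)).2 hb, ?_⟩
      rw [List.length_cons, List.length_insertIdx_of_le_length (by omega)]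
      simp [hvs]; omega
  have himg : S ∩ Function.support g = ((fun L : List ℤ => L.insertIdx k 0) '' S') ∩
      Function.support g := by
    ext L
    constructor
    · rintro ⟨hL, hs⟩
      refine ⟨⟨L.eraseIdx k, ?_, ?_⟩, hs⟩
      · have h0 : L[k]? = some 0 := by
          by_contra h
          simp [hg, h] at hs
        cases L with
        | nil => exact hL.1.elim
        | cons d L =>
          obtain ⟨hb, hl⟩ := hL
          simp only [hk, hvs, List.length_cons, List.eraseIdx_cons_succ,
            List.getElem?_cons_succ, List.cons_append, List.length_append] at hl h0 ⊢
          have e := insert_erase _ _ h0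
          have hlen : (L.eraseIdx us1.length).length = us1.length + us2.length := by
            rw [List.length_eraseIdx_of_lt (by omega)]; omega
          refine ⟨?_, ?_⟩
          · change good _ _
            rw [← good_insert us1.length _ _ (by omega), e]
            exact hb
          · simp [hvs, hlen]; try omega
      · have h0 : L[k]? = some 0 := by
          by_contra h
          simp [hg, h] at hs
        exact insert_erase _ _ h0
    · rintro ⟨⟨L', hL', rfl⟩, hs⟩
      exact ⟨hins L' hL', hs⟩
  have e1 : W m p (vs ++ u :: us2) = ∑ᶠ L ∈ S, (wl m (vs ++ 0 :: us2) (-1) L p + g L) :=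
    finsum_mem_congr rfl hsp
  rw [e1, finsum_mem_add_distrib']
  · congr 1
    · rw [hSe]; rfl
    · rw [finsum_mem_inter_support_eq g S _ himg, finsum_mem_image, W, mul_finsum_mem]
      · refine finsum_mem_congr rfl ?_
        rintro L ⟨hb, hl⟩
        have : k ≤ L.length := by rw [hl]; simp [hk]
        simp [hg, this, List.getElem?_insertIdx_self, List.eraseIdx_insertIdx_self]
      · intro a _ b _ hab
        have := congrArg (fun L => List.eraseIdx L k) hab
        simpa [List.eraseIdx_insertIdx_self] using this
  · apply f2.subset
    rintro L ⟨hL, hs⟩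
    rw [hSe] at hL
    exact ⟨hL, hs⟩
  · apply (f1.union f2).subset
    rintro L ⟨hL, hs⟩
    by_cases h : wl m (vs ++ 0 :: us2) (-1) L p = 0
    · left
      refine ⟨hL, ?_⟩
      rw [hsp L hL, h, zero_add]
      exact hs
    · right
      rw [hSe] at hL
      exact ⟨hL, h⟩

lemma W_poly (m : ℕ) (p : PP m) (us : List (RR m)) (k : ℕ) :
    W m p (0 :: (List.replicate k 0 ++ us) ++ [0]) =
      Polynomial.lsum (fun i => LinearMap.toSpanSingleton (RR m) (PP m)
        (W m p (0 :: List.replicate i 0 ++ [0])))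
        (Polynomial.X ^ k * (us.map (fun u => Polynomial.X + Polynomial.C u)).prod) := by
  induction us generalizing k with
  | nil =>
    simp [Polynomial.lsum_apply, Polynomial.X_pow_eq_monomial, Polynomial.sum_monomial_index]
  | cons u us ih =>
    have h := W_split m p 0 u (List.replicate k 0) (us ++ [0]) (by simp)
    have i1 := ih (k + 1)
    have i2 := ih k
    have e : (Polynomial.X ^ k * ((u :: us).map
        (fun u => Polynomial.X + Polynomial.C u)).prod : Polynomial (RR m)) =
        Polynomial.X ^ (k + 1) * (us.map (fun u => Polynomial.X + Polynomial.C u)).prod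
        + u • (Polynomial.X ^ k * (us.map (fun u => Polynomial.X + Polynomial.C u)).prod) := by
      rw [List.map_cons, List.prod_cons, Polynomial.smul_eq_C_mul]
      ring
    rw [e, map_add, map_smul, ← i1, ← i2, smul_eq_C_mul]
    simpa [List.replicate_succ'] using h

lemma wtT_eq (m : ℕ) (f : ℕ → RR m) (L : List ℤ) (s : ℕ) (y : ℤ) (p : PP m) :
    wtT m f s y L p = wl m ((List.range' s L.length).map f) y L p := by
  induction L generalizing s y with
  | nil => simp [wtT, wl]
  | cons d L ih =>
    simp only [wtT, Function.comp_apply, ih, List.length_cons, List.range'_succ, List.map_cons,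
      wl, stp]

lemma good_iff (L : List ℤ) (y : ℤ) : good y L ↔
    (y + L.sum = -1 ∧ ∀ j : ℕ, j < L.length → 0 ≤ y + (L.take j).sum) := by
  induction L generalizing y with
  | nil => simp [good]
  | cons d L ih =>
    simp only [good, ih, List.sum_cons, List.length_cons, add_assoc]
    constructor
    · rintro ⟨h0, h1, h2⟩
      refine ⟨h1, fun j hj => ?_⟩
      cases j with
      | zero => simpa using h0
      | succ j => simpa using h2 j (by omega)
    · rintro ⟨h1, h2⟩
      refine ⟨by simpa using h2 0 (by omega), h1, fun j hj => ?_⟩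
      simpa using h2 (j + 1) (by omega)

lemma bridge_eq (N : ℕ) : BridgeSet (-1) (N + 2) (-1) = {L | Br L ∧ L.length = N + 2} := by
  ext L
  cases L with
  | nil => simp [BridgeSet, PathSet, Br]
  | cons d L =>
    simp only [BridgeSet, PathSet, Br, Set.mem_ofPred_eq, good_iff, List.sum_cons,
      List.length_cons]
    constructor
    · rintro ⟨⟨h1, h2⟩, h3⟩
      refine ⟨⟨by omega, fun j hj => ?_⟩, h1⟩
      have := h3 (j + 1) (by omega) (by omega)
      simp at this
      omega
    · rintro ⟨⟨h2, h3⟩, h1⟩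
      refine ⟨⟨h1, by omega⟩, fun j h0 hj => ?_⟩
      obtain ⟨j, rfl⟩ : ∃ i, j = i + 1 := ⟨j - 1, by omega⟩
      have := h3 j (by omega)
      simp
      omega

lemma bridge_finite (m N : ℕ) (f : ℕ → RR m) (p : PP m) :
    {L ∈ BridgeSet (-1) (N + 2) (-1) | wtT m f 1 (-1) L p ≠ 0}.Finite := by
  apply (br_finite m ((List.range' 1 (N + 2)).map f) p).subset
  rintro L ⟨hL, hs⟩
  rw [bridge_eq] at hL
  rw [wtT_eq, hL.2] at hs
  exact ⟨⟨hL.1, by simpa using hL.2⟩, hs⟩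

lemma bridge_sum (m N : ℕ) (f : ℕ → RR m) (p : PP m) :
    ∑ᶠ L ∈ BridgeSet (-1) (N + 2) (-1), wtT m f 1 (-1) L p =
      W m p ((List.range' 1 (N + 2)).map f) := by
  unfold W
  rw [bridge_eq]
  refine finsum_mem_congr (by simp) ?_
  rintro L ⟨-, hl⟩
  rw [wtT_eq, show L.length = N + 2 by simpa using hl]

lemma list_zero (m N : ℕ) : (List.range' 1 (N + 2)).map (fun _ => (0 : RR m)) =
    0 :: List.replicate N 0 ++ [0] := by
  have : (List.range' 1 (N + 2)).map (fun _ => (0 : RR m)) = List.replicate (N + 2) 0 := by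
    simp
  rw [this, ← List.replicate_succ, ← List.replicate_succ']

lemma list_Q (m : ℕ) : (List.range' 1 (m + 2)).map (uvQ m) =
    0 :: List.ofFn (fun i => -Qv m i) ++ [0] := by
  apply List.ext_getElem
  · simp
  · intro i h1 h2
    simp only [List.length_map, List.length_range'] at h1
    rw [List.getElem_map, List.getElem_range']
    rcases Nat.eq_zero_or_pos i with rfl | hi
    · simp [uvQ]
    · obtain ⟨i, rfl⟩ : ∃ j, i = j + 1 := ⟨i - 1, by omega⟩
      by_cases him : i < m
      · have a1 : 2 ≤ 1 + 1 * (i + 1) ∧ 1 + 1 * (i + 1) ≤ m + 1 := by omega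
        simp only [uvQ, a1, and_self, dite_true, List.cons_append, List.getElem_cons_succ]
        rw [List.getElem_append_left (by simpa using him), List.getElem_ofFn]
        congr 2
        simp only [Fin.mk.injEq]
        omega
      · have a1 : ¬ (2 ≤ 1 + 1 * (i + 1) ∧ 1 + 1 * (i + 1) ≤ m + 1) := by omega
        simp only [uvQ, a1, dite_false, List.cons_append, List.getElem_cons_succ]
        rw [List.getElem_append_right (by simp; omega)]
        simp

lemma prod_Q (m : ℕ) : ((List.ofFn (fun i => -Qv m i)).map
    (fun u => Polynomial.X + Polynomial.C u)).prod =
    ∑ i ∈ Finset.range (m + 1), Polynomial.monomial i (esymNegQ m (m - i)) := by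
  have h := Multiset.prod_X_add_C_eq_sum_esymm
    ((Finset.univ : Finset (Fin m)).val.map (fun i => -Qv m i))
  rw [List.map_ofFn, List.prod_ofFn]
  simp only [Multiset.map_map, Multiset.card_map, Finset.card_val, Finset.card_univ,
    Fintype.card_fin, Finset.esymm_map_val] at h
  refine Eq.trans h ?_
  rw [← Finset.sum_range_reflect]
  refine Finset.sum_congr rfl fun i hi => ?_
  have hi := Finset.mem_range.1 hi
  rw [← Polynomial.C_mul_X_pow_eq_monomial, esymNegQ]
  congr 2
  omega

/-- **Theorem (Q-part of the path identity, used for Theorem 2.5 of the paper).**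
For `R = ℚ[ℏ,𝔟,Q_1,…,Q_m]`, the identity of `R`-linear operators on `R[p̃]`
`Σ_{i=0}^{m} e_{m−i}(−Q) · Σ_{γ ∈ Γ^{≥0}_{(0,−1)→(i+2,−1)}} wt̃(γ|0)
  = Σ_{γ ∈ Γ^{≥0}_{(0,−1)→(m+2,−1)}} wt̃(γ|(0,−Q_1,…,−Q_m,0))`
holds, and every sum over a bridge set is locally finite. -/
theorem stmt2 (m : ℕ) :
    (∀ p : PP m, ∀ i : ℕ, i ≤ m →
        {L ∈ BridgeSet (-1) (i + 2) (-1) | wtT m (fun _ => 0) 1 (-1) L p ≠ 0}.Finite) ∧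
    (∀ p : PP m,
        {L ∈ BridgeSet (-1) (m + 2) (-1) | wtT m (uvQ m) 1 (-1) L p ≠ 0}.Finite) ∧
    (∀ p : PP m,
        ∑ i ∈ Finset.range (m + 1),
            C (esymNegQ m (m - i)) *
              ∑ᶠ L ∈ BridgeSet (-1) (i + 2) (-1), wtT m (fun _ => 0) 1 (-1) L p
          = ∑ᶠ L ∈ BridgeSet (-1) (m + 2) (-1), wtT m (uvQ m) 1 (-1) L p) := by
  refine ⟨fun p i _ => bridge_finite m i _ p, fun p => bridge_finite m m _ p, fun p => ?_⟩
  simp only [bridge_sum, list_zero, list_Q]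
  have h := W_poly m p (List.ofFn (fun i => -Qv m i)) 0
  simp only [List.replicate_zero, List.nil_append, pow_zero, one_mul] at h
  rw [h, prod_Q, map_sum]
  refine Finset.sum_congr rfl fun i _ => ?_
  rw [Polynomial.lsum_apply, Polynomial.sum_monomial_index]
  · simp [smul_eq_C_mul]
  · simp


end Stmt2
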